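/- arXiv:2006.03905 — 3 statements merged into one kernel-verified Lean document; each statement's English description precedes it below -/
import Mathlib

section
/- Let (M,p) be a pointed metric space, let (M_i, p_i), i ∈ ℕ, be pointed metric spaces, and for each i let (N_i^n, q_i^n), n ∈ ℕ, be pointed metric spaces. Suppose (M_i, p_i) converges geometrically to (M,p) as i → ∞, and for each fixed i the sequence (N_i^n, q_i^n) converges geometrically to (M_i, p_i) as n → ∞. Then there exists a sequence a : ℕ → ℕ such that (N_i^{a i}, q_i^{a i}) converges geometrically to (M, p) as i → ∞. (Lemma: a geometric limit of geometric limits is a geometric limit of a diagonal subsequence.) -/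
open Metric

/-- A sequence of pointed metric spaces `(X k, x k)` converges geometrically to the
pointed metric space `(Y, y)`: for every `R > 0` and `ε > 0`, eventually there are
basepoint-preserving maps of the `R`-ball about `y` into `X k` that are
`(1+ε)`-Lipschitz and `(1+ε)`-antilipschitz on that ball. -/
def GeomConvergesTo {X : ℕ → Type*} [∀ k, MetricSpace (X k)] (x : ∀ k, X k)
    {Y : Type*} [MetricSpace Y] (y : Y) : Prop :=
  ∀ R : ℝ, 0 < R → ∀ ε : ℝ, 0 < ε → ∃ K : ℕ, ∀ k, K ≤ k →
    ∃ f : Y → X k, f y = x k ∧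
      ∀ a ∈ closedBall y R, ∀ b ∈ closedBall y R,
        (1 + ε)⁻¹ * dist a b ≤ dist (f a) (f b) ∧ dist (f a) (f b) ≤ (1 + ε) * dist a b

/-- Composing a `(1 + δ)`-bilipschitz map on a ball with a `(1 + η)`-bilipschitz map on a ball
containing the image gives a `(1 + ε)`-bilipschitz map, as soon as
`(1 + η) * (1 + δ) ≤ 1 + ε`. -/
theorem bilipschitz_comp_on_closedBall {X Y Z : Type*} [MetricSpace X] [MetricSpace Y]
    [MetricSpace Z] {x : X} {y : Y} {f : X → Y} {g : Y → Z} {R S δ η ε : ℝ}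
    (hR : 0 ≤ R) (hδ : 0 < δ) (hη : 0 < η) (hε : (1 + η) * (1 + δ) ≤ 1 + ε)
    (hS : (1 + δ) * R ≤ S) (hfx : f x = y)
    (hf : ∀ a ∈ closedBall x R, ∀ b ∈ closedBall x R,
      (1 + δ)⁻¹ * dist a b ≤ dist (f a) (f b) ∧ dist (f a) (f b) ≤ (1 + δ) * dist a b)
    (hg : ∀ a ∈ closedBall y S, ∀ b ∈ closedBall y S,
      (1 + η)⁻¹ * dist a b ≤ dist (g a) (g b) ∧ dist (g a) (g b) ≤ (1 + η) * dist a b) :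
    ∀ a ∈ closedBall x R, ∀ b ∈ closedBall x R,
      (1 + ε)⁻¹ * dist a b ≤ dist (g (f a)) (g (f b)) ∧
        dist (g (f a)) (g (f b)) ≤ (1 + ε) * dist a b := by
  have hmaps : ∀ a ∈ closedBall x R, f a ∈ closedBall y S := fun a ha => by
    rw [mem_closedBall, ← hfx]
    calc dist (f a) (f x) ≤ (1 + δ) * dist a x := (hf a ha x (mem_closedBall_self hR)).2
      _ ≤ (1 + δ) * R := by gcongr; exact ha
      _ ≤ S := hS
  intro a ha b hb
  obtain ⟨hf₁, hf₂⟩ := hf a ha b hb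
  obtain ⟨hg₁, hg₂⟩ := hg _ (hmaps a ha) _ (hmaps b hb)
  constructor
  · calc (1 + ε)⁻¹ * dist a b ≤ ((1 + η) * (1 + δ))⁻¹ * dist a b := by gcongr
      _ = (1 + η)⁻¹ * ((1 + δ)⁻¹ * dist a b) := by rw [mul_inv, mul_assoc]
      _ ≤ (1 + η)⁻¹ * dist (f a) (f b) := by gcongr
      _ ≤ dist (g (f a)) (g (f b)) := hg₁
  · calc dist (g (f a)) (g (f b)) ≤ (1 + η) * dist (f a) (f b) := hg₂
      _ ≤ (1 + η) * ((1 + δ) * dist a b) := by gcongr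
      _ = (1 + η) * (1 + δ) * dist a b := by rw [mul_assoc]
      _ ≤ (1 + ε) * dist a b := by gcongr

/-- A geometric limit of geometric limits is a geometric limit of a diagonal
subsequence. -/
theorem diagonal_geometric_limit
    {M : Type*} [MetricSpace M] (p : M)
    {Mi : ℕ → Type*} [∀ i, MetricSpace (Mi i)] (pi : ∀ i, Mi i)
    {N : ℕ → ℕ → Type*} [∀ i n, MetricSpace (N i n)] (q : ∀ i n, N i n)
    (hM : GeomConvergesTo pi p)
    (hN : ∀ i, GeomConvergesTo (fun n => q i n) (pi i)) :
    ∃ a : ℕ → ℕ, GeomConvergesTo (X := fun i => N i (a i)) (fun i => q i (a i)) p := by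
  have hpos : ∀ i : ℕ, (0 : ℝ) < i + 1 := fun i => by positivity
  choose a ha using fun i => hN i (i + 1) (hpos i) (1 / (i + 1)) (one_div_pos.2 (hpos i))
  refine ⟨a, fun R hR ε hε => ?_⟩
  obtain ⟨δ, hδ, hδ₁, hδε⟩ : ∃ δ : ℝ, 0 < δ ∧ δ ≤ 1 ∧ 3 * δ ≤ ε :=
    ⟨min 1 (ε / 3), by positivity, min_le_left _ _, by linarith [min_le_right 1 (ε / 3)]⟩
  obtain ⟨K, hK⟩ := hM R hR δ hδ
  obtain ⟨L, hL⟩ := exists_nat_ge (2 * R)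
  obtain ⟨J, hJ⟩ := exists_nat_one_div_lt hδ
  refine ⟨max K (max L J), fun i hi => ?_⟩
  obtain ⟨hKi, hLi, hJi⟩ : K ≤ i ∧ L ≤ i ∧ J ≤ i := by simpa using hi
  obtain ⟨f, hfp, hf⟩ := hK i hKi
  obtain ⟨g, hgp, hg⟩ := ha i (a i) le_rfl
  have hη : (1 : ℝ) / (i + 1) ≤ δ := (Nat.one_div_le_one_div hJi).trans hJ.le
  have hLi' : (L : ℝ) ≤ i := Nat.cast_le.2 hLi
  refine ⟨fun m => g (f m), (congrArg g hfp).trans hgp, ?_⟩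
  refine bilipschitz_comp_on_closedBall hR.le hδ (one_div_pos.2 (hpos i)) ?_ ?_ hfp hf hg
  · calc (1 + 1 / ((i : ℝ) + 1)) * (1 + δ) ≤ (1 + δ) * (1 + δ) := by gcongr
      _ ≤ 1 + ε := by nlinarith
  · nlinarith
end

section
/- Let X be a metric space, C > 0, and H : ℕ → Set X a sequence of subsets such that each H n is nonempty and compact, H (n+1) ⊆ H n, every connected component of H n has diameter at most 2^(-n) · C, and every connected component of H n contains at least two components of H (n+1). Then the intersection K = ⋂ n, H n is a nonempty, compact, perfect, totally disconnected subset of X (hence a Cantor set). -/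
open Metric

/-- A connected component of a closed set is closed. -/
theorem isClosed_connectedComponentIn_of_isClosed {X : Type*} [TopologicalSpace X] {F : Set X}
    (hF : IsClosed F) (x : X) : IsClosed (connectedComponentIn F x) := by
  by_cases hx : x ∈ F
  · rw [connectedComponentIn_eq_image hx]
    exact hF.isClosedEmbedding_subtypeVal.isClosedMap _ isClosed_connectedComponent
  · rw [connectedComponentIn_eq_empty hx]
    exact isClosed_empty

/-- If every component of each set of a nested sequence of compact sets meets the next set, then
every such component meets the intersection of the sequence. -/
theorem connectedComponentIn_inter_iInter_nonempty {X : Type*} [TopologicalSpace X] [T2Space X]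
    {H : ℕ → Set X} (hcpt : ∀ n, IsCompact (H n)) (hanti : Antitone H)
    (hmeet : ∀ n, ∀ x ∈ H n, ∃ y ∈ H (n + 1), y ∈ connectedComponentIn (H n) x)
    {n : ℕ} {x : X} (hx : x ∈ H n) :
    (connectedComponentIn (H n) x ∩ ⋂ m, H m).Nonempty := by
  choose! f hf hfx using hmeet
  let u : ℕ → X := fun k => Nat.rec x (fun k a => f (n + k) a) k
  have hu : ∀ k, u k ∈ H (n + k) := by
    intro k
    induction k with
    | zero => exact hx
    | succ k ih => exact hf (n + k) _ ih
  obtain ⟨p, hp⟩ := IsCompact.nonempty_iInter_of_sequence_nonempty_isCompact_isClosed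
    (fun k => connectedComponentIn (H (n + k)) (u k))
    (fun k => by
      rw [connectedComponentIn_eq (hfx (n + k) _ (hu k))]
      exact connectedComponentIn_mono _ (hanti (Nat.le_succ _)))
    (fun k => ⟨u k, mem_connectedComponentIn (hu k)⟩)
    ((hcpt _).of_isClosed_subset
      (isClosed_connectedComponentIn_of_isClosed (hcpt _).isClosed _)
      (connectedComponentIn_subset _ _))
    (fun k => isClosed_connectedComponentIn_of_isClosed (hcpt _).isClosed _)
  rw [Set.mem_iInter] at hp
  exact ⟨p, hp 0, Set.mem_iInter.2 fun m =>
    hanti (Nat.le_add_left m n) (connectedComponentIn_subset _ _ (hp m))⟩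

/-- The intersection of a nested sequence of nonempty compact sets, whose connected
components have diameters shrinking like `2 ^ (-n) * C` and such that each component
of `H n` contains at least two components of `H (n+1)`, is a nonempty, compact,
perfect, totally disconnected set (i.e. a Cantor set). -/
theorem cantor_set_of_nested_sets
    {X : Type*} [MetricSpace X] (C : ℝ) (hC : 0 < C) (H : ℕ → Set X)
    (hne : ∀ n, (H n).Nonempty)
    (hcpt : ∀ n, IsCompact (H n))
    (hnested : ∀ n, H (n + 1) ⊆ H n)
    (hdiam : ∀ n, ∀ x ∈ H n,
      Metric.diam (connectedComponentIn (H n) x) ≤ (2 : ℝ) ^ (-(n : ℤ)) * C)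
    (htwo : ∀ n, ∀ x ∈ H n, ∃ y ∈ H (n + 1), ∃ z ∈ H (n + 1),
      y ∈ connectedComponentIn (H n) x ∧ z ∈ connectedComponentIn (H n) x ∧
      connectedComponentIn (H (n + 1)) y ≠ connectedComponentIn (H (n + 1)) z) :
    (⋂ n, H n).Nonempty ∧ IsCompact (⋂ n, H n) ∧ Perfect (⋂ n, H n) ∧
      IsTotallyDisconnected (⋂ n, H n) := by
  have hanti : Antitone H := antitone_nat_of_succ_le hnested
  have hK : IsCompact (⋂ n, H n) :=
    (hcpt 0).of_isClosed_subset (isClosed_iInter fun n => (hcpt n).isClosed)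
      (Set.iInter_subset _ 0)
  have hdist : ∀ n, ∀ x ∈ H n, ∀ y ∈ connectedComponentIn (H n) x,
      dist y x ≤ (2 : ℝ) ^ (-(n : ℤ)) * C := fun n x hx y hy =>
    (dist_le_diam_of_mem ((hcpt n).isBounded.subset (connectedComponentIn_subset _ _)) hy
      (mem_connectedComponentIn hx)).trans (hdiam n x hx)
  have hsmall : ∀ ε > 0, ∃ n : ℕ, (2 : ℝ) ^ (-(n : ℤ)) * C < ε := by
    intro ε hε
    obtain ⟨n, hn⟩ := exists_pow_lt_of_lt_one (div_pos hε hC) (by norm_num : (2⁻¹ : ℝ) < 1)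
    refine ⟨n, ?_⟩
    rw [zpow_neg, zpow_natCast, ← inv_pow]
    exact (lt_div_iff₀ hC).1 hn
  refine ⟨IsCompact.nonempty_iInter_of_sequence_nonempty_isCompact_isClosed H hnested hne
    (hcpt 0) fun n => (hcpt n).isClosed, hK, ⟨hK.isClosed, ?_⟩, ?_⟩
  · intro x hxK
    rw [accPt_iff_nhds]
    intro U hU
    obtain ⟨ε, hε, hεU⟩ := Metric.mem_nhds_iff.1 hU
    obtain ⟨n, hn⟩ := hsmall ε hε
    have hx := Set.mem_iInter.1 hxK n
    obtain ⟨y, hy, z, hz, hyx, hzx, hyz⟩ := htwo n x hx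
    have key : ∀ w ∈ H (n + 1), w ∈ connectedComponentIn (H n) x →
        ∃ p ∈ U ∩ ⋂ m, H m, p ∈ connectedComponentIn (H (n + 1)) w := by
      intro w hw hwx
      obtain ⟨p, hpw, hpK⟩ := connectedComponentIn_inter_iInter_nonempty hcpt hanti
        (fun m a ha => by
          obtain ⟨b, hb, -, -, hba, -⟩ := htwo m a ha
          exact ⟨b, hb, hba⟩) hw
      refine ⟨p, ⟨hεU ((hdist n x hx p ?_).trans_lt hn), hpK⟩, hpw⟩
      rw [connectedComponentIn_eq hwx]
      exact connectedComponentIn_mono _ (hnested n) hpw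
    obtain ⟨p, hp, hpy⟩ := key y hy hyx
    obtain ⟨q, hq, hqz⟩ := key z hz hzx
    by_cases hpx : p = x
    · refine ⟨q, hq, fun hqx => hyz ?_⟩
      rw [connectedComponentIn_eq hpy, connectedComponentIn_eq hqz, hpx, hqx]
    · exact ⟨p, hp, hpx⟩
  · intro S hSK hS x hx y hy
    by_contra hxy
    obtain ⟨n, hn⟩ := hsmall (dist x y) (dist_pos.2 hxy)
    have hSn : S ⊆ H n := hSK.trans (Set.iInter_subset _ n)
    exact (hdist n y (hSn hy) x (hS.subset_connectedComponentIn hy hSn hx)).not_gt hn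
end

section
/- Let X be a metric space, C > 0, and H : ℕ → Set X a sequence of subsets such that each H n is nonempty and compact, H (n+1) ⊆ H n, and every connected component of H n has diameter at most 2^(-n) · C. Then the intersection K = ⋂ n, H n is totally disconnected: every connected subset of K is a subsingleton. -/
open Metric

/-- The intersection of a nested sequence of nonempty compact sets whose connected
components have diameters shrinking like `2 ^ (-n) * C` is totally disconnected:
every connected subset of the intersection is a subsingleton. -/
theorem totallyDisconnected_of_nested_sets
    {X : Type*} [MetricSpace X] (C : ℝ) (hC : 0 < C) (H : ℕ → Set X)
    (hne : ∀ n, (H n).Nonempty)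
    (hcpt : ∀ n, IsCompact (H n))
    (hnested : ∀ n, H (n + 1) ⊆ H n)
    (hdiam : ∀ n, ∀ x ∈ H n,
      Metric.diam (connectedComponentIn (H n) x) ≤ (2 : ℝ) ^ (-(n : ℤ)) * C) :
    IsTotallyDisconnected (⋂ n, H n) := by
  intro t ht hconn x hx y hy
  have hdist (n : ℕ) : dist x y ≤ (2⁻¹ : ℝ) ^ n * C := by
    have htn : t ⊆ H n := ht.trans (Set.iInter_subset H n)
    have hsub := hconn.subset_connectedComponentIn hx htn
    have hbdd : Bornology.IsBounded (connectedComponentIn (H n) x) :=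
      (hcpt n).isBounded.subset (connectedComponentIn_subset _ _)
    calc
      dist x y ≤ diam (connectedComponentIn (H n) x) :=
        dist_le_diam_of_mem hbdd (hsub hx) (hsub hy)
      _ ≤ (2 : ℝ) ^ (-(n : ℤ)) * C := hdiam n x (htn hx)
      _ = (2⁻¹ : ℝ) ^ n * C := by rw [zpow_neg, zpow_natCast, inv_pow]
  have hlim : Filter.Tendsto (fun n : ℕ ↦ (2⁻¹ : ℝ) ^ n * C) Filter.atTop (nhds 0) := by
    simpa using (tendsto_pow_atTop_nhds_zero_of_lt_one (r := (2⁻¹ : ℝ))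
      (by norm_num) (by norm_num)).mul_const C
  exact dist_le_zero.mp (ge_of_tendsto' hlim hdist)
end
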